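/- For a smooth real-valued function f on the circle S¹, one has the pointwise identity f(α)·(|∂_α| f)(α) = (1/(8π)) ∫₀^{2π} (f(α) − f(β))² / sin²((α−β)/2) dβ + (1/2)·(|∂_α|(f²))(α), where |∂_α| = H∘∂_α and H is the periodic Hilbert transform. -/

import Mathlib

open MeasureTheory Real

/-- Fourier coefficient of a `2π`-periodic real function. -/
noncomputable def fc (f : ℝ → ℝ) (n : ℤ) : ℂ :=
  (1 / (2 * Real.pi)) * ∫ β in (0:ℝ)..(2 * Real.pi),
    (f β : ℂ) * Complex.exp (-Complex.I * n * β)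

/-- The operator `|∂_α|`, the Fourier multiplier with symbol `|ξ|`
(equal to `H ∘ ∂_α` with `H` the periodic Hilbert transform). -/
noncomputable def absD (f : ℝ → ℝ) (α : ℝ) : ℂ :=
  ∑' n : ℤ, ((|n| : ℝ) : ℂ) * fc f n * Complex.exp (Complex.I * n * α)

lemma fc_deriv (g : ℝ → ℝ) (hg : ContDiff ℝ 1 g) (hper : Function.Periodic g (2 * Real.pi)) (n : ℤ) :
    fc (deriv g) n = Complex.I * n * fc g n := by
  have hd : ∀ x, HasDerivAt g (deriv g x) x := fun x => (hg.differentiable (by norm_num) x).hasDerivAt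
  have hdc : Continuous (deriv g) := hg.continuous_deriv (by norm_num)
  have he : ∀ x : ℝ, HasDerivAt (fun β : ℝ => Complex.exp (-Complex.I * n * β))
      (Complex.exp (-Complex.I * n * x) * (-Complex.I * n)) x := by
    intro x
    have h1 : HasDerivAt (fun β : ℝ => -Complex.I * n * (β:ℂ)) (-Complex.I * n * 1) x :=
      (Complex.ofRealCLM.hasDerivAt (x := x)).const_mul _
    simpa using h1.cexp
  have hib := intervalIntegral.integral_mul_deriv_eq_deriv_mul (a := 0) (b := 2 * Real.pi)
    (u := fun x => (g x : ℂ)) (u' := fun x => ((deriv g x : ℝ) : ℂ))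
    (fun x _ => (hd x).ofReal_comp) (fun x _ => he x)
    (Continuous.intervalIntegrable (by fun_prop) _ _) (Continuous.intervalIntegrable (by fun_prop) _ _)
  have hp : g (2 * Real.pi) = g 0 := by simpa using hper 0
  have hE : Complex.exp (-Complex.I * n * ((2 * Real.pi : ℝ) : ℂ)) = 1 := by
    rw [Complex.exp_eq_one_iff]
    exact ⟨-n, by push_cast; ring⟩
  rw [hp, hE] at hib
  simp only [Complex.ofReal_zero, mul_zero, Complex.exp_zero, sub_self, zero_sub, ← mul_assoc] at hib
  rw [intervalIntegral.integral_mul_const, intervalIntegral.integral_mul_const] at hib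
  unfold fc
  linear_combination (1 / (2 * (Real.pi:ℂ))) * hib

lemma fc_bound (g : ℝ → ℝ) (hg : Continuous g) : ∃ C : ℝ, ∀ n, ‖fc g n‖ ≤ C := by
  refine ⟨‖(1 / (2 * Real.pi) : ℂ)‖ * |∫ β in (0:ℝ)..(2 * Real.pi), ‖g β‖|, fun n => ?_⟩
  unfold fc
  rw [norm_mul]
  gcongr
  refine intervalIntegral.norm_integral_le_abs_integral_norm.trans (le_of_eq ?_)
  congr 2
  ext x
  have : -Complex.I * n * x = ((-(n * x) : ℝ) : ℂ) * Complex.I := by push_cast; ring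
  rw [norm_mul, this, Complex.norm_exp_ofReal_mul_I]
  simp

lemma fc_iter (k : ℕ) : ∀ (g : ℝ → ℝ) (_ : ContDiff ℝ (⊤ : ℕ∞) g)
    (_ : Function.Periodic g (2 * Real.pi)),
    ∃ C : ℝ, ∀ n : ℤ, |(n:ℝ)| ^ k * ‖fc g n‖ ≤ C := by
  induction k with
  | zero => intro g hg _; simpa using fc_bound g hg.continuous
  | succ k ih =>
    intro g hg hp
    have h1 : ContDiff ℝ (⊤ : ℕ∞) (deriv g) := (contDiff_infty_iff_deriv.1 hg).2
    have h2 : Function.Periodic (deriv g) (2 * Real.pi) := by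
      intro x
      rw [← deriv_comp_add_const]
      congr 1
      ext y; exact hp y
    obtain ⟨C, hC⟩ := ih _ h1 h2
    refine ⟨C, fun n => ?_⟩
    have := hC n
    rw [fc_deriv g (hg.of_le (by exact_mod_cast le_top)) hp, norm_mul, norm_mul] at this
    simp only [Complex.norm_I, one_mul, Complex.norm_intCast] at this
    rw [pow_succ, mul_assoc]; exact this

lemma fc_summable (g : ℝ → ℝ) (hg : ContDiff ℝ (⊤ : ℕ∞) g)
    (hp : Function.Periodic g (2 * Real.pi)) :
    Summable (fun n : ℤ => |(n:ℝ)| ^ 2 * ‖fc g n‖) := by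
  obtain ⟨C, hC⟩ := fc_iter 4 g hg hp
  have h0 : 0 ≤ C := le_trans (by positivity) (hC 0)
  refine Summable.of_nonneg_of_le (fun n => by positivity) (fun n => ?_)
    ((Real.summable_one_div_int_pow (p := 2)).2 (by norm_num) |>.mul_left C)
  rcases eq_or_ne n 0 with rfl | hn
  · simp
  · have hn' : (0:ℝ) < |(n:ℝ)| := by positivity
    rw [← sq_abs (n:ℝ), mul_one_div, le_div_iff₀ (by positivity)]
    calc _ = |(n:ℝ)| ^ 4 * ‖fc g n‖ := by ring
      _ ≤ C := hC n

lemma fc_summable0 (g : ℝ → ℝ) (hg : ContDiff ℝ (⊤ : ℕ∞) g)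
    (hp : Function.Periodic g (2 * Real.pi)) :
    Summable (fun n : ℤ => fc g n) := by
  have h := (fc_summable g hg hp).add
    (summable_of_ne_finset_zero (f := fun n : ℤ => if n = 0 then ‖fc g 0‖ else 0) (s := {0})
      (by intro b hb; simp at hb; simp [hb]))
  refine Summable.of_norm_bounded h (fun n => ?_)
  rcases eq_or_ne n 0 with rfl | hn
  · simp
  · have : (1:ℝ) ≤ |(n:ℝ)| := by exact_mod_cast Int.one_le_abs hn
    simp only [hn, if_false, add_zero]
    have h2 : (1:ℝ) ≤ |(n:ℝ)| ^ 2 := one_le_pow₀ this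
    nlinarith [norm_nonneg (fc g n)]

lemma fourier_inv (g : ℝ → ℝ) (hg : ContDiff ℝ (⊤ : ℕ∞) g)
    (hp : Function.Periodic g (2 * Real.pi)) (x : ℝ) :
    HasSum (fun n : ℤ => fc g n * Complex.exp (Complex.I * n * x)) (g x : ℂ) := by
  have : Fact (0 < 2 * Real.pi) := ⟨by positivity⟩
  have hpc : Function.Periodic (fun x => (g x : ℂ)) (2 * Real.pi) := fun x => by simp [hp x]
  let F : C(AddCircle (2 * Real.pi), ℂ) :=
    ⟨hpc.lift, continuous_coinduced_dom.mpr (Complex.continuous_ofReal.comp hg.continuous)⟩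
  have hF : ∀ y : ℝ, F (y : AddCircle (2 * Real.pi)) = g y := fun y => hpc.lift_coe y
  have hpi : (Real.pi : ℂ) ≠ 0 := by exact_mod_cast Real.pi_ne_zero
  have hc : ∀ n, fourierCoeff F n = fc g n := by
    intro n
    rw [fourierCoeff_eq_intervalIntegral F n 0, zero_add]
    unfold fc
    rw [Complex.real_smul]
    push_cast
    congr 1
    refine intervalIntegral.integral_congr fun y _ => ?_
    simp only [hF, fourier_coe_apply, smul_eq_mul]
    rw [mul_comm]
    congr 2
    push_cast
    field_simp
  have hs : Summable (fourierCoeff F) := by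
    rw [show fourierCoeff F = fc g from funext hc]; exact fc_summable0 g hg hp
  have h := has_pointwise_sum_fourier_series_of_summable hs (x : AddCircle (2 * Real.pi))
  rw [hF] at h
  convert h using 2 with n
  rw [hc, fourier_coe_apply, smul_eq_mul]
  congr 2
  push_cast
  field_simp

noncomputable def dK (n : ℕ) (t : ℝ) : ℝ := 1 + ∑ k ∈ Finset.range n, 2 * Real.cos ((k + 1) * t)
noncomputable def fK (n : ℕ) (t : ℝ) : ℝ := ∑ k ∈ Finset.range n, dK k t

lemma dK_cont (n : ℕ) : Continuous (dK n) := by unfold dK; fun_prop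
lemma fK_cont (n : ℕ) : Continuous (fK n) := by
  unfold fK; exact continuous_finsetSum _ fun k _ => dK_cont k

lemma dK_abs (n : ℕ) (t : ℝ) : |dK n t| ≤ 2 * n + 1 := by
  induction n with
  | zero => simp [dK]
  | succ n ih =>
    have : dK (n+1) t = dK n t + 2 * Real.cos ((n + 1) * t) := by
      simp only [dK, Finset.sum_range_succ]; ring
    rw [this]
    push_cast
    have := abs_add_le (dK n t) (2 * Real.cos ((n + 1) * t))
    have h2 := Real.abs_cos_le_one ((n + 1) * t)
    rw [abs_mul] at this
    norm_num at this
    linarith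

lemma fK_abs (n : ℕ) (t : ℝ) : |fK n t| ≤ (n:ℝ) ^ 2 := by
  induction n with
  | zero => simp [fK]
  | succ n ih =>
    have : fK (n+1) t = fK n t + dK n t := by simp only [fK, Finset.sum_range_succ]
    rw [this]
    push_cast
    have := abs_add_le (fK n t) (dK n t)
    have := dK_abs n t
    nlinarith

lemma dK_sin (n : ℕ) (t : ℝ) :
    dK n t * Real.sin (t / 2) ^ 2 * 2 = Real.cos (n * t) - Real.cos ((n + 1) * t) := by
  have hs : Real.sin (t / 2) ^ 2 * 2 = 1 - Real.cos t := by
    have := Real.cos_sq (t / 2)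
    rw [mul_div_cancel₀ t two_ne_zero] at this
    have := Real.sin_sq_add_cos_sq (t / 2)
    linarith
  rw [mul_assoc, hs]
  induction n with
  | zero => simp [dK]
  | succ n ih =>
    have : dK (n+1) t = dK n t + 2 * Real.cos ((n + 1) * t) := by
      simp only [dK, Finset.sum_range_succ]; ring
    rw [this, add_mul, ih]
    push_cast
    have h1 : Real.cos ((n + 1 + 1) * t) = Real.cos ((n+1) * t + t) := by ring_nf
    have h2 : Real.cos (n * t) = Real.cos ((n+1) * t - t) := by ring_nf
    rw [h1, h2, Real.cos_add, Real.cos_sub]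
    ring

lemma fK_sin (n : ℕ) (t : ℝ) :
    fK n t * Real.sin (t / 2) ^ 2 * 2 = 1 - Real.cos (n * t) := by
  induction n with
  | zero => simp [fK]
  | succ n ih =>
    have : fK (n+1) t = fK n t + dK n t := by simp only [fK, Finset.sum_range_succ]
    rw [this, add_mul, add_mul, ih, dK_sin]
    push_cast; ring

lemma dK_int (n : ℕ) : ∫ t in (0:ℝ)..(2 * Real.pi), dK n t = 2 * Real.pi := by
  unfold dK
  rw [intervalIntegral.integral_add (by simp) (Continuous.intervalIntegrable (by fun_prop) _ _),
    intervalIntegral.integral_finsetSum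
      (fun i _ => Continuous.intervalIntegrable (by fun_prop) _ _)]
  rw [Finset.sum_eq_zero]
  · simp
  · intro k _
    have hk : ((k:ℝ) + 1) ≠ 0 := by positivity
    rw [intervalIntegral.integral_const_mul, intervalIntegral.integral_comp_mul_left _ hk, integral_cos]
    have : Real.sin ((k + 1) * (2 * Real.pi)) = 0 := by
      have := Real.sin_nat_mul_pi ((k + 1) * 2)
      rw [← this]; push_cast; ring_nf
    simp [this]

lemma fK_int (n : ℕ) : ∫ t in (0:ℝ)..(2 * Real.pi), fK n t = 2 * Real.pi * n := by
  unfold fK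
  rw [intervalIntegral.integral_finsetSum
      (fun i _ => (dK_cont i).intervalIntegrable _ _)]
  simp [dK_int]; ring

lemma absD_formula (g : ℝ → ℝ) (hg : ContDiff ℝ (⊤ : ℕ∞) g)
    (hp : Function.Periodic g (2 * Real.pi)) (α : ℝ) :
    IntervalIntegrable (fun t => (2 * g α - g (α + t) - g (α - t)) / Real.sin (t / 2) ^ 2)
      volume 0 (2 * Real.pi) ∧
    absD g α = ((1 / (8 * Real.pi) * ∫ t in (0:ℝ)..(2 * Real.pi),
      (2 * g α - g (α + t) - g (α - t)) / Real.sin (t / 2) ^ 2 : ℝ) : ℂ) := by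
  have hpos : (0:ℝ) ≤ 2 * Real.pi := by positivity
  let F : ℤ → C(ℝ, ℂ) := fun n =>
    ⟨fun t => fc g n * Complex.exp (Complex.I * n * α) * (4 * (fK n.natAbs t : ℂ)), by
      have := fK_cont n.natAbs
      fun_prop⟩
  have hbd : ∀ n t, ‖F n t‖ ≤ 4 * (|(n:ℝ)| ^ 2 * ‖fc g n‖) := by
    intro n t
    have h1 : Complex.I * n * α = ((n * α : ℝ) : ℂ) * Complex.I := by push_cast; ring
    have h2 := fK_abs n.natAbs t
    rw [Nat.cast_natAbs, Int.cast_abs] at h2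
    simp only [F, ContinuousMap.coe_mk, norm_mul, h1, Complex.norm_exp_ofReal_mul_I,
      Complex.norm_real, Real.norm_eq_abs]
    norm_num
    norm_num at h2
    nlinarith [norm_nonneg (fc g n)]
  have hsum := (fc_summable g hg hp).mul_left 4
  have hcont : Continuous (fun t => ∑' n, F n t) :=
    continuous_tsum (fun n => (F n).continuous) hsum hbd
  have hEq : ∀ t ∈ Set.Ioo 0 (2 * Real.pi), ∑' n, F n t =
      (((2 * g α - g (α + t) - g (α - t)) / Real.sin (t / 2) ^ 2 : ℝ) : ℂ) := by
    intro t ht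
    have hsin : 0 < Real.sin (t / 2) :=
      Real.sin_pos_of_pos_of_lt_pi (by linarith [ht.1]) (by linarith [ht.2])
    have h := (((fourier_inv g hg hp α).mul_left 2).sub (fourier_inv g hg hp (α + t))).sub
      (fourier_inv g hg hp (α - t))
    have h := h.div_const ((Real.sin (t / 2) ^ 2 : ℝ) : ℂ)
    rw [show (((2 * g α - g (α + t) - g (α - t)) / Real.sin (t / 2) ^ 2 : ℝ) : ℂ) =
      (2 * (g α : ℂ) - g (α + t) - g (α - t)) / ((Real.sin (t / 2) ^ 2 : ℝ) : ℂ) by push_cast; rfl]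
    rw [← h.tsum_eq]
    refine tsum_congr fun n => ?_
    have hne : ((Real.sin (t / 2) ^ 2 : ℝ) : ℂ) ≠ 0 := by
      exact_mod_cast (pow_pos hsin 2).ne'
    rw [eq_div_iff hne]
    have hk := fK_sin n.natAbs t
    have hcos : Real.cos ((n.natAbs : ℝ) * t) = Real.cos (n * t) := by
      rw [Nat.cast_natAbs, Int.cast_abs]
      rcases abs_choice (n:ℝ) with h | h <;> rw [h]
      rw [neg_mul, Real.cos_neg]
    rw [hcos] at hk
    have hk' : (fK n.natAbs t : ℂ) * ((Real.sin (t / 2) ^ 2 : ℝ) : ℂ) * 2 = 1 - Complex.cos (n * t) := by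
      have := congrArg (fun x : ℝ => (x : ℂ)) hk
      push_cast at this ⊢
      exact this
    have e1 : Complex.exp (Complex.I * n * (α + t : ℝ)) =
        Complex.exp (Complex.I * n * α) * Complex.exp (n * t * Complex.I) := by
      rw [← Complex.exp_add]; congr 1; push_cast; ring
    have e2 : Complex.exp (Complex.I * n * (α - t : ℝ)) =
        Complex.exp (Complex.I * n * α) * Complex.exp (-(n * t) * Complex.I) := by
      rw [← Complex.exp_add]; congr 1; push_cast; ring
    have e3 := Complex.two_cos (n * t)
    rw [e1, e2]
    simp only [F, ContinuousMap.coe_mk]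
    linear_combination 2 * fc g n * Complex.exp (Complex.I * n * α) * hk' -
      fc g n * Complex.exp (Complex.I * n * α) * e3
  have hII : IntervalIntegrable (fun t =>
      (((2 * g α - g (α + t) - g (α - t)) / Real.sin (t / 2) ^ 2 : ℝ) : ℂ))
      volume 0 (2 * Real.pi) := by
    refine (hcont.intervalIntegrable 0 (2 * Real.pi)).congr_ae ?_
    rw [Set.uIoc_of_le hpos, ← Measure.restrict_congr_set Ioo_ae_eq_Ioc]
    exact (ae_restrict_iff' measurableSet_Ioo).2 (Filter.Eventually.of_forall hEq)
  refine ⟨?_, ?_⟩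
  · rw [intervalIntegrable_iff] at hII ⊢
    exact hII.re
  · have hI : ∫ t in (0:ℝ)..(2 * Real.pi), ∑' n, F n t = ((∫ t in (0:ℝ)..(2 * Real.pi),
        (2 * g α - g (α + t) - g (α - t)) / Real.sin (t / 2) ^ 2 : ℝ) : ℂ) := by
      rw [← intervalIntegral.integral_ofReal]
      rw [intervalIntegral.integral_of_le hpos, intervalIntegral.integral_of_le hpos,
        integral_Ioc_eq_integral_Ioo, integral_Ioc_eq_integral_Ioo]
      exact setIntegral_congr_fun measurableSet_Ioo hEq
    have hs := intervalIntegral.hasSum_integral_of_dominated_convergence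
      (μ := volume) (a := 0) (b := 2 * Real.pi)
      (F := fun n t => F n t) (f := fun t => ∑' n, F n t)
      (fun n _ => 4 * (|(n:ℝ)| ^ 2 * ‖fc g n‖))
      (fun n => (F n).continuous.aestronglyMeasurable)
      (fun n => Filter.Eventually.of_forall fun t _ => hbd n t)
      (Filter.Eventually.of_forall fun t _ => hsum)
      (by simp)
      (Filter.Eventually.of_forall fun t _ =>
        (Summable.of_norm_bounded hsum (fun n => hbd n t)).hasSum)
    rw [hI] at hs
    have hs := hs.mul_left (1 / (8 * (Real.pi:ℂ)))
    unfold absD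
    push_cast at hs ⊢
    rw [← hs.tsum_eq]
    refine tsum_congr fun n => ?_
    have hpi : (Real.pi : ℂ) ≠ 0 := by exact_mod_cast Real.pi_ne_zero
    simp only [F, ContinuousMap.coe_mk]
    rw [intervalIntegral.integral_const_mul, intervalIntegral.integral_const_mul,
      intervalIntegral.integral_ofReal, fK_int, Nat.cast_natAbs, Int.cast_abs]
    push_cast
    field_simp
    ring

theorem f_absD_identity (f : ℝ → ℝ) (hf : ContDiff ℝ (⊤ : ℕ∞) f)
    (hper : Function.Periodic f (2 * Real.pi)) (α : ℝ) :
    (f α : ℂ) * absD f α =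
      ((1 / (8 * Real.pi)) * ∫ β in (0:ℝ)..(2 * Real.pi),
          (f α - f β)^2 / (Real.sin ((α - β) / 2))^2 : ℝ)
      + (1/2) * absD (fun x => (f x)^2) α := by
  obtain ⟨i1, h1⟩ := absD_formula f hf hper α
  obtain ⟨i2, h2⟩ := absD_formula (fun x => (f x)^2) (hf.pow 2) (fun x => by simp [hper x]) α
  rw [h1, h2]
  set Q : ℝ → ℝ := fun t => (f α - f (α + t)) ^ 2 / Real.sin (t / 2) ^ 2 with hQ
  have hpos : (0:ℝ) ≤ 2 * Real.pi := by positivity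
  have hs2 : ∀ t : ℝ, Real.sin (t / 2) ^ 2 = (1 - Real.cos t) / 2 := by
    intro t
    have := Real.cos_sq (t / 2)
    rw [mul_div_cancel₀ t two_ne_zero] at this
    have := Real.sin_sq_add_cos_sq (t / 2)
    linarith
  have hQp : Function.Periodic Q (2 * Real.pi) := by
    intro t
    simp only [hQ, hs2, Real.cos_add_two_pi]
    rw [← add_assoc, hper]
  have hcomb : ∀ t, f α * ((2 * f α - f (α + t) - f (α - t)) / Real.sin (t / 2) ^ 2) -
      1 / 2 * ((2 * f α ^ 2 - f (α + t) ^ 2 - f (α - t) ^ 2) / Real.sin (t / 2) ^ 2)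
      = 1 / 2 * (Q t + Q (-t)) := by
    intro t
    simp only [hQ, hs2, Real.cos_neg, ← sub_eq_add_neg]
    ring
  have i3 := (i1.const_mul (f α)).sub (i2.const_mul (1 / 2))
  have hQm : Measurable Q := by
    have := hf.continuous.measurable
    fun_prop
  have hQ0 : ∀ t, 0 ≤ Q t := fun t => by simp only [hQ]; positivity
  have iQ : IntervalIntegrable Q volume 0 (2 * Real.pi) := by
    refine (i3.const_mul 2).mono_fun hQm.aestronglyMeasurable
      (Filter.Eventually.of_forall fun t => ?_)
    simp only [hcomb]
    rw [Real.norm_of_nonneg (hQ0 t), Real.norm_of_nonneg (by linarith [hQ0 t, hQ0 (-t)])]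
    linarith [hQ0 (-t)]
  have hrefl : ∀ t, Q (-t) = Q (2 * Real.pi - t) := fun t => by
    rw [← hQp (-t)]; congr 1; ring
  have iQ' : IntervalIntegrable (fun t => Q (-t)) volume 0 (2 * Real.pi) := by
    have := (iQ.comp_sub_left (2 * Real.pi)).symm
    simp only [sub_zero, sub_self] at this
    simpa only [hrefl] using this
  have e1 : ∫ t in (0:ℝ)..(2 * Real.pi), Q (-t) = ∫ t in (0:ℝ)..(2 * Real.pi), Q t := by
    simp only [hrefl]
    rw [intervalIntegral.integral_comp_sub_left]; simp
  have e2 : ∫ β in (0:ℝ)..(2 * Real.pi), (f α - f β)^2 / (Real.sin ((α - β) / 2))^2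
      = ∫ t in (0:ℝ)..(2 * Real.pi), Q t := by
    have : ∀ β, (f α - f β)^2 / (Real.sin ((α - β) / 2))^2 = Q (β - α) := by
      intro β
      simp only [hQ, hs2]
      rw [show β - α = -(α - β) by ring, Real.cos_neg]
      congr 4; ring
    simp only [this]
    rw [intervalIntegral.integral_comp_sub_right]
    have := hQp.intervalIntegral_add_eq (0 - α) 0
    rw [zero_add] at this
    rw [← this]; congr 1; ring
  have e3 := intervalIntegral.integral_sub (i1.const_mul (f α)) (i2.const_mul (1 / 2))
  simp only [hcomb] at e3
  rw [intervalIntegral.integral_const_mul, intervalIntegral.integral_add iQ iQ', e1,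
    intervalIntegral.integral_const_mul, intervalIntegral.integral_const_mul] at e3
  rw [e2]
  have key : f α * (1 / (8 * Real.pi) * ∫ t in (0:ℝ)..(2 * Real.pi),
      (2 * f α - f (α + t) - f (α - t)) / Real.sin (t / 2) ^ 2) =
      1 / (8 * Real.pi) * (∫ t in (0:ℝ)..(2 * Real.pi), Q t) + 1 / 2 * (1 / (8 * Real.pi) *
      ∫ t in (0:ℝ)..(2 * Real.pi),
      (2 * f α ^ 2 - f (α + t) ^ 2 - f (α - t) ^ 2) / Real.sin (t / 2) ^ 2) := by
    linear_combination (-(1 / (8 * Real.pi))) * e3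
  have := congrArg (fun x : ℝ => (x : ℂ)) key
  push_cast at this ⊢
  exact this
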